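/- Let M ≥ 1 and let X₁, …, X_M and Y be random variables on a common probability space taking values in finite nonempty measurable spaces. For each i let g_i be a measurable map on the value space of X_i and set Z_i = g_i(X_i), with all Z_i valued in the same finite space. If Z₁ = Z₂ = ⋯ = Z_M almost surely, then the mutual information of the aligned representation with the target is bounded by that of the least informative modality: I((Z₁,…,Z_M); Y) ≤ min_{1≤i≤M} I(X_i; Y). -/

import Mathlib

open MeasureTheory ProbabilityTheory Real ENNReal

namespace Paper

variable {Ω : Type*} [MeasurableSpace Ω]

/-- Shannon entropy (natural log) of a finitely-valued random variable `X` under `μ`. -/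
noncomputable def entropy {S : Type*} [Fintype S] [MeasurableSpace S]
    (X : Ω → S) (μ : Measure Ω) : ℝ :=
  ∑ s : S, Real.negMulLog ((μ.map X) {s}).toReal

/-- Shannon conditional entropy `H(Y | X)`:
the average over the values `s` of `X` of the entropy of `Y` under the
conditional measure `μ[|X ⁻¹' {s}]`. -/
noncomputable def condEntropy {S T : Type*} [Fintype S] [MeasurableSpace S]
    [Fintype T] [MeasurableSpace T]
    (Y : Ω → T) (X : Ω → S) (μ : Measure Ω) : ℝ :=
  ∑ s : S, ((μ.map X) {s}).toReal * entropy Y (ProbabilityTheory.cond μ (X ⁻¹' {s}))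

/-- Shannon mutual information `I(X ; Y) = H(Y) - H(Y | X)`. -/
noncomputable def mutualInfo {S T : Type*} [Fintype S] [MeasurableSpace S]
    [Fintype T] [MeasurableSpace T]
    (X : Ω → S) (Y : Ω → T) (μ : Measure Ω) : ℝ :=
  entropy Y μ - condEntropy Y X μ


lemma condEntropy_eq {S T : Type*} [Fintype S] [MeasurableSpace S] [MeasurableSingletonClass S]
    [Fintype T] [MeasurableSpace T] [MeasurableSingletonClass T]
    {Y : Ω → T} {X : Ω → S} (μ : Measure Ω) [IsProbabilityMeasure μ]
    (hX : Measurable X) (hY : Measurable Y) :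
    condEntropy Y X μ = ∑ s : S, ∑ t : T, μ.real (X ⁻¹' {s}) *
      Real.negMulLog (μ.real (X ⁻¹' {s} ∩ Y ⁻¹' {t}) / μ.real (X ⁻¹' {s})) := by
  unfold condEntropy entropy
  refine Finset.sum_congr rfl fun s _ => ?_
  rw [Finset.mul_sum]
  refine Finset.sum_congr rfl fun t _ => ?_
  rw [Measure.map_apply hX (measurableSet_singleton s),
    Measure.map_apply hY (measurableSet_singleton t),
    cond_apply (hX (measurableSet_singleton s)), ENNReal.toReal_mul, ENNReal.toReal_inv]
  simp only [Measure.real, div_eq_inv_mul]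

lemma real_fiber {S W : Type*} [Fintype S] [MeasurableSpace S] [MeasurableSingletonClass S]
    [DecidableEq W] {X : Ω → S} (μ : Measure Ω) [IsProbabilityMeasure μ]
    (hX : Measurable X) (f : S → W) (w : W) (B : Set Ω) (hB : MeasurableSet B) :
    μ.real ((fun ω => f (X ω)) ⁻¹' {w} ∩ B)
      = ∑ s ∈ Finset.univ.filter (fun s => f s = w), μ.real (X ⁻¹' {s} ∩ B) := by
  rw [← measureReal_biUnion_finset]
  · congr 1
    ext ω
    simp
  · intro a _ b _ hab
    refine Set.disjoint_left.2 fun ω h1 h2 => hab ?_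
    exact h1.1.symm.trans h2.1
  · intro s _
    exact (hX (measurableSet_singleton s)).inter hB

lemma jensen_step {S : Type*} (F : Finset S) (p q : S → ℝ) (hq : ∀ s, 0 ≤ q s)
    (hqp : ∀ s, q s ≤ p s) :
    ∑ s ∈ F, p s * Real.negMulLog (q s / p s)
      ≤ (∑ s ∈ F, p s) * Real.negMulLog ((∑ s ∈ F, q s) / ∑ s ∈ F, p s) := by
  have hp : ∀ s, 0 ≤ p s := fun s => (hq s).trans (hqp s)
  rcases (Finset.sum_nonneg fun s (_ : s ∈ F) => hp s).eq_or_lt with h | h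
  · have h0 := (Finset.sum_eq_zero_iff_of_nonneg fun s (_ : s ∈ F) => hp s).1 h.symm
    rw [← h, zero_mul]
    exact (Finset.sum_eq_zero fun s hs => by rw [h0 s hs, zero_mul]).le
  · have J := Real.concaveOn_negMulLog.le_map_sum (t := F)
      (w := fun s => p s / ∑ s ∈ F, p s) (p := fun s => q s / p s)
      (fun s _ => div_nonneg (hp s) h.le)
      (by rw [← Finset.sum_div, div_self h.ne'])
      (fun s _ => div_nonneg (hq s) (hp s))
    simp only [smul_eq_mul] at J
    have e1 : ∀ s, p s / (∑ s ∈ F, p s) * (q s / p s) = q s / ∑ s ∈ F, p s := by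
      intro s
      rcases (hp s).eq_or_lt with h1 | h1
      · have : q s = 0 := le_antisymm (h1 ▸ hqp s) (hq s)
        simp [this]
      · field_simp
    simp only [e1, div_mul_eq_mul_div, ← Finset.sum_div] at J
    rwa [div_le_iff₀ h, mul_comm] at J

lemma condEntropy_le {S T W : Type*} [Fintype S] [MeasurableSpace S] [DiscreteMeasurableSpace S]
    [Fintype T] [MeasurableSpace T] [MeasurableSingletonClass T]
    [Fintype W] [MeasurableSpace W] [MeasurableSingletonClass W]
    {Y : Ω → T} {X : Ω → S} {Z : Ω → W} (μ : Measure Ω) [IsProbabilityMeasure μ]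
    (hX : Measurable X) (hY : Measurable Y) (hZ : Measurable Z) (f : S → W)
    (h : Z =ᵐ[μ] fun ω => f (X ω)) :
    condEntropy Y X μ ≤ condEntropy Y Z μ := by
  classical
  rw [condEntropy_eq μ hX hY, condEntropy_eq μ hZ hY]
  have e2 : ∀ w t, μ.real (Z ⁻¹' {w} ∩ Y ⁻¹' {t})
      = ∑ s ∈ Finset.univ.filter (fun s => f s = w), μ.real (X ⁻¹' {s} ∩ Y ⁻¹' {t}) := by
    intro w t
    rw [← real_fiber μ hX f w _ (hY (measurableSet_singleton t))]
    apply measureReal_congr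
    filter_upwards [h] with ω hω
    change (Z ω ∈ ({w} : Set W) ∧ _) = (f (X ω) ∈ ({w} : Set W) ∧ _)
    rw [hω]
  have e1 : ∀ w, μ.real (Z ⁻¹' {w})
      = ∑ s ∈ Finset.univ.filter (fun s => f s = w), μ.real (X ⁻¹' {s}) := by
    intro w
    have := real_fiber μ hX f w Set.univ MeasurableSet.univ
    simp only [Set.inter_univ] at this
    rw [← this]
    apply measureReal_congr
    filter_upwards [h] with ω hω
    change (Z ω ∈ ({w} : Set W)) = (f (X ω) ∈ ({w} : Set W))
    rw [hω]
  rw [← Finset.sum_fiberwise Finset.univ f]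
  refine Finset.sum_le_sum fun w _ => ?_
  rw [Finset.sum_comm]
  refine Finset.sum_le_sum fun t _ => ?_
  rw [e1, e2]
  exact jensen_step _ _ _ (fun s => measureReal_nonneg)
    (fun s => measureReal_mono Set.inter_subset_left)

/-- If the encoded features `Z i = g i ∘ X i` are perfectly aligned
almost surely, then `I((Z₁,…,Z_M) ; Y) ≤ min_i I(X i ; Y)`. -/
theorem mutualInfo_aligned_le_inf
    (μ : Measure Ω) [IsProbabilityMeasure μ]
    {M : ℕ} (hM : 1 ≤ M)
    {𝒳 : Fin M → Type*} [∀ i, Fintype (𝒳 i)] [∀ i, Nonempty (𝒳 i)]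
    [∀ i, MeasurableSpace (𝒳 i)] [∀ i, DiscreteMeasurableSpace (𝒳 i)]
    {𝒴 : Type*} [Fintype 𝒴] [Nonempty 𝒴] [MeasurableSpace 𝒴] [DiscreteMeasurableSpace 𝒴]
    {𝒵 : Type*} [Fintype 𝒵] [Nonempty 𝒵] [MeasurableSpace 𝒵] [DiscreteMeasurableSpace 𝒵]
    (X : ∀ i, Ω → 𝒳 i) (Y : Ω → 𝒴) (g : ∀ i, 𝒳 i → 𝒵)
    (hX : ∀ i, Measurable (X i)) (hY : Measurable Y) (hg : ∀ i, Measurable (g i))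
    (halign : ∀ i j, (fun ω => g i (X i ω)) =ᵐ[μ] (fun ω => g j (X j ω))) :
    mutualInfo (fun ω => fun i => g i (X i ω)) Y μ
      ≤ Finset.univ.inf' ⟨⟨0, hM⟩, Finset.mem_univ _⟩ (fun i => mutualInfo (X i) Y μ) := by
  refine Finset.le_inf' _ _ fun i _ => ?_
  unfold mutualInfo
  refine sub_le_sub_left (condEntropy_le μ (hX i) hY
    (measurable_pi_lambda _ fun j => (hg j).comp (hX j)) (fun x _ => g i x) ?_) _
  filter_upwards [ae_all_iff.2 fun j => halign j i] with ω hω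
  funext j
  exact hω j

end Paper
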